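/- Let d ≥ 2, let q be an odd prime power, let R ⊆ F_q \ {0}, let S be a set of ‖·‖-spheres in F_q^d whose radii all lie in R, and let P ⊆ F_q^d. Then |I(P,S) − q^{−1}|P||S|| ≤ 2·√(q^{d−1}|R||P||S|). -/

import Mathlib

open Finset

section Defs
variable {F : Type*} [Field F] [Fintype F] [DecidableEq F]

/-- `x₁x₂ + x₃x₄ + ⋯` : the sum of the first `k` products of consecutive pairs
of coordinates. -/
def pairsForm {d : ℕ} (k : ℕ) (x : Fin d → F) : F :=
  ∑ j ∈ Finset.range k, if h : 2*j+1 < d then x ⟨2*j, by omega⟩ * x ⟨2*j+1, h⟩ else 0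

/-- `Q₁^d(x) = x₁x₂ + x₃x₄ + ⋯ + x_{d−1}x_d` (for even `d`). -/
def Q1form {d : ℕ} (x : Fin d → F) : F := pairsForm (d/2) x

/-- `Q₂^d(x) = x₁x₂ + ⋯ + x_{d−3}x_{d−2} + x_{d−1}² − a·x_d²` (for even `d`,
`a` a non-square). -/
def Q2form (a : F) {d : ℕ} (x : Fin d → F) : F :=
  pairsForm ((d-2)/2) x +
    (if h : 2 ≤ d then x ⟨d-2, by omega⟩ ^ 2 - a * x ⟨d-1, by omega⟩ ^ 2 else 0)

/-- `Q₃^d(x) = x₁x₂ + ⋯ + x_{d−2}x_{d−1} − x_d²` (for odd `d`). -/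
def Q3form {d : ℕ} (x : Fin d → F) : F :=
  pairsForm ((d-1)/2) x - (if h : 1 ≤ d then x ⟨d-1, by omega⟩ ^ 2 else 0)

/-- `Q₄^d(x) = x₁x₂ + ⋯ + x_{d−2}x_{d−1} − a·x_d²` (for odd `d`, `a` a non-square). -/
def Q4form (a : F) {d : ℕ} (x : Fin d → F) : F :=
  pairsForm ((d-1)/2) x - (if h : 1 ≤ d then a * x ⟨d-1, by omega⟩ ^ 2 else 0)

/-- The quadratic form `Q_i^d`. -/
def Qi (a : F) (i : ℕ) {d : ℕ} (x : Fin d → F) : F :=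
  if i = 1 then Q1form x else if i = 2 then Q2form a x
  else if i = 3 then Q3form x else Q4form a x

/-- `‖x‖ = x₁² + ⋯ + x_d²`. -/
def normForm {d : ℕ} (x : Fin d → F) : F := ∑ i, x i ^ 2

/-- `I(P,S)`: the number of incidences between a set `P` of points and a set `S`
of `Qf`-spheres, each sphere given as a (center, radius) pair. -/
def sphIncid {d : ℕ} (Qf : (Fin d → F) → F)
    (P : Finset (Fin d → F)) (S : Finset ((Fin d → F) × F)) : ℕ :=
  ((P ×ˢ S).filter fun z => Qf (z.1 - z.2.1) = z.2.2).card

/-- The set of points of the `Qf`-sphere `s` (given as a (center, radius) pair). -/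
def spherePts {d : ℕ} (Qf : (Fin d → F) → F) (s : (Fin d → F) × F) : Finset (Fin d → F) :=
  Finset.univ.filter fun x => Qf (x - s.1) = s.2

end Defs

section Stepanov
open Polynomial

variable {E : Type*} [Field E]

lemma mem_degreeLT_succ_iff {n : ℕ} {f : E[X]} : f ∈ degreeLT E (n + 1) ↔ f.natDegree ≤ n := by
  rw [mem_degreeLT]
  rcases eq_or_ne f 0 with rfl | hf
  · simp
  · rw [← natDegree_lt_iff_degree_lt hf, Nat.lt_succ_iff]

/-- Uniqueness of base-`X ^ s` expansions of polynomials. -/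
lemma eq_zero_of_eval_X_pow_eq_zero {s : ℕ} {f : E[X][X]}
    (hdeg : ∀ j, (f.coeff j).natDegree < s) (hf : f.eval (X ^ s) = 0) : f = 0 := by
  obtain ⟨n, hn⟩ : ∃ n, f.natDegree < n := ⟨_, Nat.lt_succ_self _⟩
  induction n generalizing f with
  | zero => omega
  | succ n ih =>
    have hdecomp := divX_mul_X_add f
    have heval : f.divX.eval (X ^ s) * X ^ s + f.coeff 0 = 0 := by
      rw [← hf]
      conv_rhs => rw [← hdecomp]
      simp
    have hcoeff : f.coeff 0 = 0 := by
      have hdvd : (X : E[X]) ^ s ∣ f.coeff 0 := by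
        rw [← dvd_add_right (Dvd.intro_left _ rfl), heval]
        exact dvd_zero _
      refine eq_zero_of_dvd_of_natDegree_lt hdvd ?_
      simpa using hdeg 0
    have hdiv : f.divX = 0 := by
      by_cases hzero : f.natDegree = 0
      · rw [eq_C_of_natDegree_eq_zero hzero]; simp
      · apply ih
        · intro j
          simpa [coeff_divX] using hdeg (j + 1)
        · rw [hcoeff, add_zero] at heval
          exact (mul_eq_zero.mp heval).resolve_right (pow_ne_zero _ X_ne_zero)
        · rw [natDegree_divX_eq_natDegree_tsub_one]; omega
    rw [← hdecomp, hdiv, hcoeff]; simp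

lemma natDegree_coeff_mul_le {f g : E[X][X]} {m n : ℕ} (hf : ∀ j, (f.coeff j).natDegree ≤ m)
    (hg : ∀ j, (g.coeff j).natDegree ≤ n) (j : ℕ) : ((f * g).coeff j).natDegree ≤ m + n := by
  rw [coeff_mul]
  refine natDegree_sum_le_of_forall_le _ _ fun x _ => ?_
  exact natDegree_mul_le.trans (add_le_add (hf _) (hg _))

/-- A polynomial of the shape `U(X ^ s) + D ^ ((s + 1) / 2) V(X ^ s)` with `U`, `V` of small degree
in the coefficients vanishes only if `U = V = 0`, provided `D` is not a square. -/
lemma eq_zero_of_eval_add_pow_mul_eval_eq_zero {p e l h : ℕ} [Fact p.Prime] [CharP E p]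
    (hs : p ^ e = 2 * l + 1) (hl : h ≤ l) {D : E[X]} (hD : D.Monic) (hdeg : D.natDegree = 2 * h)
    (hsq : ∀ u v : E[X], u ^ 2 = D * v ^ 2 → v = 0) {U V : E[X][X]}
    (hU : ∀ j, (U.coeff j).natDegree ≤ l) (hV : ∀ j, (V.coeff j).natDegree ≤ l - h)
    (h0 : U.eval (X ^ (2 * l + 1)) + D ^ (l + 1) * V.eval (X ^ (2 * l + 1)) = 0) :
    U = 0 ∧ V = 0 := by
  let D' : E[X] := D.map (iterateFrobenius E p e)
  have hD' : (D'.map C).eval (X ^ (2 * l + 1)) = D ^ (2 * l + 1) := by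
    rw [← hs, ← map_iterateFrobenius_expand p D e, map_expand, eval_map]
    rfl
  have hzero : U ^ 2 - C D * D'.map C * V ^ 2 = 0 := by
    apply eq_zero_of_eval_X_pow_eq_zero (s := 2 * l + 1)
    · intro j
      rw [coeff_sub]
      refine Nat.lt_succ_of_le ((natDegree_sub_le _ _).trans (max_le ?_ ?_))
      · rw [sq]
        exact (natDegree_coeff_mul_le hU hU j).trans (by omega)
      · rw [mul_assoc, coeff_C_mul, sq]
        refine natDegree_mul_le.trans ?_
        have hc : ∀ j, ((D'.map C).coeff j).natDegree ≤ 0 := fun j => by simp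
        have := natDegree_coeff_mul_le hc (natDegree_coeff_mul_le hV hV) j
        omega
    · simp only [eval_sub, eval_mul, eval_pow, eval_C, hD']
      linear_combination (U.eval (X ^ (2 * l + 1)) - D ^ (l + 1) * V.eval (X ^ (2 * l + 1))) * h0
  have hlead := congrArg leadingCoeff (sub_eq_zero.mp hzero)
  have hmonic : (D'.map C).Monic := (hD.map _).map _
  rw [leadingCoeff_pow, leadingCoeff_mul, leadingCoeff_mul, leadingCoeff_pow, leadingCoeff_C,
    hmonic.leadingCoeff, mul_one] at hlead
  have hV0 : V = 0 := leadingCoeff_eq_zero.mp (hsq _ _ hlead)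
  refine ⟨?_, hV0⟩
  rw [hV0] at hzero
  simpa using hzero

/-- Pigeonhole step of Stepanov's method: the linear conditions on the coefficients of the auxiliary
polynomial have a nonzero solution. -/
lemma exists_auxiliary_coefficients [Fintype E] {p e l h : ℕ} [Fact p.Prime] [CharP E p]
    (hs : p ^ e = 2 * l + 1) (hl : h ≤ l) {D : E[X]} (hdeg : D.natDegree = 2 * h) (ε : E) :
    ∃ (a : Fin (l + h + 1) → E[X]) (b : Fin (l + 1) → E[X]),
      (∀ j, (a j).natDegree ≤ l) ∧ (∀ j, (b j).natDegree ≤ l - h) ∧ (a ≠ 0 ∨ b ≠ 0) ∧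
      ∑ j, a j ^ (2 * l + 1) * X ^ (j : ℕ) +
        C ε * D ^ (l + 1) * ∑ j, b j ^ (2 * l + 1) * X ^ (j : ℕ) = 0 := by
  classical
  let A := (Fin (l + h + 1) → degreeLT E (l + 1)) × (Fin (l + 1) → degreeLT E (l - h + 1))
  let B := degreeLT E (l * (2 * l + 1) + (l + h) + 1)
  have hcard (n : ℕ) : Nat.card (degreeLT E n) = Fintype.card E ^ n := by
    rw [Nat.card_congr (degreeLTEquiv E n).toEquiv]; simp
  have hfin (n : ℕ) : Finite (degreeLT E n) := Finite.of_equiv _ (degreeLTEquiv E n).symm.toEquiv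
  let Φ : A → E[X] := fun z => ∑ j, (z.1 j : E[X]) ^ (2 * l + 1) * X ^ (j : ℕ) +
    C ε * D ^ (l + 1) * ∑ j, (z.2 j : E[X]) ^ (2 * l + 1) * X ^ (j : ℕ)
  have hmem (z : A) : Φ z ∈ B := by
    rw [mem_degreeLT_succ_iff]
    refine (natDegree_add_le _ _).trans (max_le ?_ ?_)
    · refine natDegree_sum_le_of_forall_le _ _ fun j _ => ?_
      have h1 := mem_degreeLT_succ_iff.mp (z.1 j).2
      have h2 := j.2
      refine natDegree_mul_le.trans (add_le_add (natDegree_pow_le.trans ?_) ?_)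
      · rw [mul_comm]; gcongr
      · rw [natDegree_X_pow]; omega
    · rw [mul_assoc, Finset.mul_sum]
      refine (natDegree_C_mul_le _ _).trans (natDegree_sum_le_of_forall_le _ _ fun j _ => ?_)
      have h1 := mem_degreeLT_succ_iff.mp (z.2 j).2
      have h2 := j.2
      refine natDegree_mul_le.trans ?_
      refine (add_le_add (natDegree_pow_le.trans (le_of_eq (by rw [hdeg])))
        (natDegree_mul_le.trans (add_le_add (natDegree_pow_le.trans
          (Nat.mul_le_mul_left _ h1)) (natDegree_X_pow _).le))).trans ?_
      obtain ⟨k, rfl⟩ := Nat.exists_eq_add_of_le hl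
      rw [Nat.add_sub_cancel_left]
      nlinarith
  have hlt : Nat.card B < Nat.card A := by
    simp only [A, B, Nat.card_prod, Nat.card_pi, hcard, Finset.prod_const, Finset.card_univ,
      Fintype.card_fin, ← pow_mul, ← pow_add]
    apply Nat.pow_lt_pow_right Fintype.one_lt_card
    obtain ⟨k, rfl⟩ := Nat.exists_eq_add_of_le hl
    rw [Nat.add_sub_cancel_left]
    nlinarith
  obtain ⟨z, w, hzw, heq⟩ : ∃ z w : A, z ≠ w ∧ Φ z = Φ w := by
    by_contra! hinj
    refine hlt.not_ge (Nat.card_le_card_of_injective (fun z => (⟨Φ z, hmem z⟩ : B)) ?_)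
    intro z w hzw
    by_contra hne
    exact hinj z w hne (congrArg Subtype.val hzw)
  refine ⟨fun j => z.1 j - w.1 j, fun j => z.2 j - w.2 j, fun j => ?_, fun j => ?_, ?_, ?_⟩
  · exact mem_degreeLT_succ_iff.mp (sub_mem (z.1 j).2 (w.1 j).2)
  · exact mem_degreeLT_succ_iff.mp (sub_mem (z.2 j).2 (w.2 j).2)
  · by_contra! hboth
    apply hzw
    refine Prod.ext (funext fun j => Subtype.ext ?_) (funext fun j => Subtype.ext ?_)
    · exact sub_eq_zero.mp (congrFun hboth.1 j)
    · exact sub_eq_zero.mp (congrFun hboth.2 j)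
  · simp only [← hs, sub_pow_char_pow, sub_mul, Finset.sum_sub_distrib, mul_sub]
    simp only [Φ, ← hs] at heq
    linear_combination heq

/-- Stepanov's bound for the number of points at which a non-square polynomial `D` takes values of
prescribed quadratic character. -/
lemma stepanov_card_le [Fintype E] [DecidableEq E] {p e l h : ℕ} [Fact p.Prime] [CharP E p]
    (hs : p ^ e = 2 * l + 1) (hE : Fintype.card E = (2 * l + 1) ^ 2) (hl : h ≤ l) {D : E[X]}
    (hD : D.Monic) (hdeg : D.natDegree = 2 * h)
    (hsq : ∀ u v : E[X], u ^ 2 = D * v ^ 2 → v = 0) (ε : E) :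
    2 * #{x : E | D.eval x ^ (2 * l * (l + 1)) = ε} ≤
      (2 * l + 1) ^ 2 + 2 * h * (2 * l + 1) := by
  obtain ⟨a, b, ha, hb, hne, hab⟩ := exists_auxiliary_coefficients hs hl hdeg ε
  let U : E[X][X] := ∑ j : Fin (l + h + 1), monomial (j : ℕ) (a j)
  let V : E[X][X] := ∑ j : Fin (l + 1), monomial (j : ℕ) (b j)
  have hcoeff {n m : ℕ} {c : Fin n → E[X]} (hc : ∀ j, (c j).natDegree ≤ m) (i : ℕ) :
      ((∑ j : Fin n, monomial (j : ℕ) (c j)).coeff i).natDegree ≤ m := by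
    rw [finsetSum_coeff]
    refine natDegree_sum_le_of_forall_le _ _ fun j _ => ?_
    rw [coeff_monomial]
    split_ifs
    · exact hc j
    · simp
  have hinj {n : ℕ} {c : Fin n → E[X]} (hc : ∑ j : Fin n, monomial (j : ℕ) (c j) = 0) : c = 0 := by
    funext i
    have := congrArg (fun f => coeff f (i : ℕ)) hc
    simpa [finsetSum_coeff, coeff_monomial, Fin.val_inj] using this
  let Ψ : E[X] := U.eval (X ^ (2 * l + 1)) + D ^ (l + 1) * V.eval (X ^ (2 * l + 1))
  have hΨ : Ψ = ∑ j, a j * (X ^ (2 * l + 1)) ^ (j : ℕ) +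
      D ^ (l + 1) * ∑ j, b j * (X ^ (2 * l + 1)) ^ (j : ℕ) := by
    simp [Ψ, U, V, eval_finsetSum]
  have hΨ0 : Ψ ≠ 0 := fun h0 => by
    obtain ⟨hU, hV⟩ := eq_zero_of_eval_add_pow_mul_eval_eq_zero hs hl hD hdeg hsq
      (hcoeff ha) (hcoeff hb) h0
    rcases hne with h | h
    · exact h (hinj hU)
    · exact h (hinj hV)
  have hroot (x : E) (hx : D.eval x ^ (2 * l * (l + 1)) = ε) : Ψ.eval x = 0 := by
    have hx2 : x ^ ((2 * l + 1) * (2 * l + 1)) = x := by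
      rw [← sq, ← hE]; exact FiniteField.pow_card x
    have hpow : Ψ.eval x ^ (2 * l + 1) = 0 := by
      have hval := congrArg (eval x) hab
      simp only [eval_add, eval_mul, eval_finsetSum, eval_pow, eval_X, eval_C, eval_zero] at hval
      rw [hΨ, ← hval]
      simp only [eval_add, eval_mul, eval_finsetSum, eval_pow, eval_X]
      rw [← hs, add_pow_char_pow, mul_pow, sum_pow_char_pow, sum_pow_char_pow, hs]
      congr 1
      · refine Finset.sum_congr rfl fun j _ => ?_
        rw [mul_pow, ← pow_mul, ← pow_mul, mul_left_comm, pow_mul' x, hx2]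
      · congr 1
        · rw [← hx]; ring
        · refine Finset.sum_congr rfl fun j _ => ?_
          rw [mul_pow, ← pow_mul, ← pow_mul, mul_left_comm, pow_mul' x, hx2]
    exact pow_eq_zero_iff (by omega) |>.mp hpow
  have hΨdeg : Ψ.natDegree ≤ l + (l + h) * (2 * l + 1) := by
    rw [hΨ]
    refine (natDegree_add_le _ _).trans (max_le ?_ ?_)
    · refine natDegree_sum_le_of_forall_le _ _ fun j _ => ?_
      have h2 := j.2
      refine natDegree_mul_le.trans (add_le_add (ha j) ?_)
      rw [← pow_mul, natDegree_X_pow, mul_comm]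
      exact Nat.mul_le_mul_right _ (by omega)
    · rw [Finset.mul_sum]
      refine natDegree_sum_le_of_forall_le _ _ fun j _ => ?_
      have h2 : (j : ℕ) ≤ l := by omega
      rw [← pow_mul]
      refine natDegree_mul_le.trans ?_
      refine (add_le_add (natDegree_pow_le.trans (le_of_eq (by rw [hdeg])))
        (natDegree_mul_le.trans (add_le_add (hb j) ((natDegree_X_pow _).le.trans
          (Nat.mul_le_mul_left _ h2))))).trans ?_
      obtain ⟨k, rfl⟩ := Nat.exists_eq_add_of_le hl
      rw [Nat.add_sub_cancel_left]
      nlinarith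
  have hle : #{x : E | D.eval x ^ (2 * l * (l + 1)) = ε} ≤ Ψ.natDegree := by
    refine (Finset.card_le_card (t := Ψ.roots.toFinset) fun x hx => ?_).trans
      ((Multiset.toFinset_card_le _).trans (card_roots' _))
    rw [Multiset.mem_toFinset, mem_roots hΨ0]
    exact hroot x (by simpa using hx)
  nlinarith

end Stepanov

section KloostermanSum
open Polynomial

lemma abs_sum_quadraticChar_eval_le {E : Type*} [Field E] [Fintype E] [DecidableEq E]
    {p e l h : ℕ} [Fact p.Prime] [CharP E p]
    (hs : p ^ e = 2 * l + 1) (hE : Fintype.card E = (2 * l + 1) ^ 2) (hl : h ≤ l) {D : E[X]}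
    (hD : D.Monic) (hdeg : D.natDegree = 2 * h)
    (hsq : ∀ u v : E[X], u ^ 2 = D * v ^ 2 → v = 0) :
    |∑ y, quadraticChar E (D.eval y)| ≤ 4 * h * (2 * l + 1) := by
  have hodd : Fintype.card E % 2 = 1 := by
    rw [hE, Nat.pow_mod]; simp [Nat.add_mod]
  have hF : ringChar E ≠ 2 := fun h2 => by
    have := FiniteField.even_card_of_char_two h2
    omega
  have hhalf : Fintype.card E / 2 = 2 * l * (l + 1) := by
    rw [hE, show (2 * l + 1) ^ 2 = 2 * (2 * l * (l + 1)) + 1 by ring]; omega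
  have hhalf0 : 2 * l * (l + 1) ≠ 0 := by
    rw [← hhalf]
    have := Fintype.one_lt_card (α := E)
    omega
  have hne : (-1 : E) ≠ 1 := Ring.neg_one_ne_one_of_char_ne_two hF
  have hpos := stepanov_card_le hs hE hl hD hdeg hsq 1
  have hneg := stepanov_card_le hs hE hl hD hdeg hsq (-1)
  have hzero : #{x : E | D.eval x = 0} ≤ 2 * h := by
    rw [← hdeg]
    refine (Finset.card_le_card (t := D.roots.toFinset) fun x hx => ?_).trans
      ((Multiset.toFinset_card_le _).trans (card_roots' _))
    rw [Multiset.mem_toFinset, mem_roots hD.ne_zero]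
    simpa using hx
  have hpt (x : E) : quadraticChar E (D.eval x) =
        (if D.eval x ^ (2 * l * (l + 1)) = 1 then 1 else 0) -
        (if D.eval x ^ (2 * l * (l + 1)) = -1 then 1 else 0) ∧
      (1 : ℤ) = (if D.eval x ^ (2 * l * (l + 1)) = 1 then 1 else 0) +
        (if D.eval x ^ (2 * l * (l + 1)) = -1 then 1 else 0) +
        (if D.eval x = 0 then 1 else 0) := by
    have hpow := quadraticChar_eq_pow_of_char_ne_two' hF (D.eval x)
    rw [hhalf] at hpow
    rw [← hpow]
    by_cases h0 : D.eval x = 0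
    · simp [h0]
    · rcases quadraticChar_dichotomy h0 with h1 | h1 <;> simp [h1, h0, hne, hne.symm]
  have hsum : ∑ y, quadraticChar E (D.eval y) =
      (#{x : E | D.eval x ^ (2 * l * (l + 1)) = 1} : ℤ) -
        #{x : E | D.eval x ^ (2 * l * (l + 1)) = -1} := by
    rw [Finset.sum_congr rfl fun x _ => (hpt x).1, Finset.sum_sub_distrib]
    simp
  have htot : ((2 * l + 1) ^ 2 : ℤ) =
      (#{x : E | D.eval x ^ (2 * l * (l + 1)) = 1} : ℤ) +
        #{x : E | D.eval x ^ (2 * l * (l + 1)) = -1} + #{x : E | D.eval x = 0} := by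
    have : (Fintype.card E : ℤ) = ∑ x : E, (1 : ℤ) := by simp
    rw [hE, Finset.sum_congr rfl fun x _ => (hpt x).2, Finset.sum_add_distrib,
      Finset.sum_add_distrib] at this
    simpa using this
  zify at hpos hneg hzero
  rw [hsum, abs_le]
  constructor <;> nlinarith

/-- `G ^ 2 - c` is not a square, even up to square factors, if `G` is nonconstant and `c ≠ 0`. -/
lemma eq_zero_of_sq_eq_sq_sub_C_mul_sq {E : Type*} [Field E] {G : E[X]}
    (hdeg : G.natDegree ≠ 0) (h2 : (2 : E) ≠ 0) {c : E} (hc : c ≠ 0) (u v : E[X])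
    (huv : u ^ 2 = (G ^ 2 - C c) * v ^ 2) : v = 0 := by
  by_contra hv
  obtain ⟨w, rfl⟩ : v ∣ u :=
    (UniqueFactorizationMonoid.pow_dvd_pow_iff_dvd two_ne_zero).mp (Dvd.intro_left _ huv.symm)
  have hw : w ^ 2 = G ^ 2 - C c := by
    apply mul_right_cancel₀ (pow_ne_zero 2 hv)
    rw [← huv]; ring
  have hfac : (G - w) * (G + w) = C c := by linear_combination -hw
  have hunit : IsUnit ((G - w) * (G + w)) := hfac ▸ isUnit_C.mpr hc.isUnit
  have h1 := natDegree_eq_zero_of_isUnit (isUnit_of_mul_isUnit_left hunit)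
  have h3 := natDegree_eq_zero_of_isUnit (isUnit_of_mul_isUnit_right hunit)
  apply hdeg
  have h4 : C 2 * G = (G - w) + (G + w) := by rw [C_ofNat]; ring
  rw [← natDegree_C_mul h2, h4]
  have := natDegree_add_le (G - w) (G + w)
  omega

/-- The Kloosterman sum of the additive character `ψ` with parameter `a`. -/
noncomputable def kloostermanSum {E : Type*} [Field E] [Fintype E] [DecidableEq E]
    (ψ : AddChar E ℂ) (a : E) : ℂ :=
  ∑ x : E with x ≠ 0, ψ (x + a * x⁻¹)

variable {E : Type*} [Field E] [Fintype E] [DecidableEq E]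

lemma card_filter_sq_eq (hF : ringChar E ≠ 2) (c : E) :
    (#{z : E | z ^ 2 = c} : ℤ) = quadraticChar E c + 1 := by
  rw [← quadraticChar_card_sqrts hF c]
  congr 2
  ext; simp

lemma kloostermanSum_eq_sum_quadraticChar (hF : ringChar E ≠ 2) {ψ : AddChar E ℂ} (hψ : ψ ≠ 1)
    {a : E} (ha : a ≠ 0) :
    kloostermanSum ψ a = ∑ u, (quadraticChar E (u ^ 2 - 4 * a) : ℂ) * ψ u := by
  have h2 : (2 : E) ≠ 0 := Ring.two_ne_zero hF
  have hfib (u : E) : (#{x ∈ ({x : E | x ≠ 0} : Finset E) | x + a * x⁻¹ = u} : ℂ) =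
      quadraticChar E (u ^ 2 - 4 * a) + 1 := by
    have := card_filter_sq_eq hF (u ^ 2 - 4 * a)
    rw [← Int.cast_one, ← Int.cast_add, ← this, Int.cast_natCast, Nat.cast_inj]
    refine Finset.card_nbij' (fun x => 2 * x - u) (fun z => (z + u) / 2) ?_ ?_ ?_ ?_
    · intro x hx
      simp only [coe_filter, mem_filter, mem_univ, true_and, Set.mem_ofPred_eq] at hx ⊢
      obtain ⟨hx0, rfl⟩ := hx
      field_simp
      ring
    · intro z hz
      simp only [coe_filter, mem_filter, mem_univ, true_and, Set.mem_ofPred_eq] at hz ⊢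
      have hprod : (z + u) * (u - z) = 4 * a := by linear_combination -hz
      have hz0 : z + u ≠ 0 := fun h0 => by
        rw [h0, zero_mul, show (4 : E) = 2 * 2 by norm_num] at hprod
        exact mul_ne_zero (mul_ne_zero h2 h2) ha hprod.symm
      refine ⟨div_ne_zero hz0 h2, ?_⟩
      field_simp
      linear_combination -hprod
    · intro x _; simp only; field_simp; ring
    · intro z _; simp only; field_simp; ring
  rw [kloostermanSum, ← Finset.sum_fiberwise (s := {x : E | x ≠ 0}) (g := fun x => x + a * x⁻¹)]
  have (u : E) : ∑ x ∈ ({x : E | x ≠ 0} : Finset E) with x + a * x⁻¹ = u, ψ (x + a * x⁻¹) =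
      (quadraticChar E (u ^ 2 - 4 * a) + 1) * ψ u := by
    rw [← hfib, ← nsmul_eq_mul, ← Finset.sum_const]
    refine Finset.sum_congr rfl fun x hx => ?_
    rw [(Finset.mem_filter.mp hx).2]
  simp only [this, add_mul, one_mul, Finset.sum_add_distrib]
  rw [(AddChar.sum_eq_zero_iff_ne_zero (ψ := ψ)).mpr hψ, add_zero]

/-- A Weil-type bound for Kloosterman sums over a field with `s ^ 2` elements whose additive
character is invariant under the `q`-power Frobenius; the constant depends on `q` only. -/
lemma norm_kloostermanSum_le_of_frobenius_invariant {p e f l : ℕ} [Fact p.Prime] [CharP E p]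
    (hs : p ^ e = 2 * l + 1) (hE : Fintype.card E = (2 * l + 1) ^ 2) (hl : p ^ f ≤ l) (hf : f ≠ 0)
    {ψ : AddChar E ℂ} (hψ : ψ ≠ 1) (hinv : ∀ y, ψ (y ^ p ^ f) = ψ y) {a : E} (ha : a ≠ 0) :
    ‖kloostermanSum ψ a‖ ≤ 4 * p ^ f * (2 * l + 1) := by
  have hF : ringChar E ≠ 2 := fun h2 => by
    have := FiniteField.even_card_of_char_two h2
    rw [hE, Nat.pow_mod] at this
    simp [Nat.add_mod] at this
  have h2 : (2 : E) ≠ 0 := Ring.two_ne_zero hF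
  have h4a : 4 * a ≠ 0 := by
    rw [show (4 : E) = 2 * 2 by norm_num]
    exact mul_ne_zero (mul_ne_zero h2 h2) ha
  have hpf : 1 < p ^ f := Nat.one_lt_pow hf (Fact.out : p.Prime).one_lt
  have hshift (u : E) :
      |∑ y : E, quadraticChar E ((y ^ p ^ f - y + u) ^ 2 - 4 * a)| ≤
        4 * (p ^ f : ℕ) * (2 * l + 1) := by
    let G : E[X] := X ^ p ^ f + (-X + C u)
    have hdlt : (-X + C u : E[X]).degree < ((p ^ f : ℕ) : WithBot ℕ) := by
      refine lt_of_le_of_lt (b := ((1 : ℕ) : WithBot ℕ)) ?_ (by exact_mod_cast hpf)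
      compute_degree
      exact le_rfl
    have hG : G.Monic := monic_X_pow_add hdlt
    have hGdeg : G.natDegree = p ^ f := by
      rw [natDegree_eq_of_degree_eq_some]
      rw [degree_add_eq_left_of_degree_lt (by rwa [degree_X_pow]), degree_X_pow]
    have hG2 : (G ^ 2).natDegree = 2 * p ^ f := by rw [natDegree_pow, hGdeg]
    have hClt : (C (4 * a)).degree < (G ^ 2).degree := by
      apply degree_lt_degree
      rw [natDegree_C, hG2]
      omega
    have hD : (G ^ 2 - C (4 * a)).Monic := (hG.pow 2).sub_of_left hClt
    have hDdeg : (G ^ 2 - C (4 * a)).natDegree = 2 * p ^ f := by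
      rw [natDegree_sub_eq_left_of_natDegree_lt (by rw [natDegree_C, hG2]; omega), hG2]
    have := abs_sum_quadraticChar_eval_le hs hE hl hD hDdeg
      (eq_zero_of_sq_eq_sq_sub_C_mul_sq (by omega) h2 h4a)
    have heval (y : E) : (G ^ 2 - C (4 * a)).eval y = (y ^ p ^ f - y + u) ^ 2 - 4 * a := by
      simp [G]; ring
    simpa only [heval] using this
  let g : E → ℂ := fun u => (quadraticChar E (u ^ 2 - 4 * a) : ℂ)
  have htrans (y : E) : ∑ u, g (y ^ p ^ f - y + u) * ψ u = kloostermanSum ψ a := by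
    rw [kloostermanSum_eq_sum_quadraticChar hF hψ ha,
      ← Equiv.sum_comp (Equiv.addLeft (y ^ p ^ f - y)) (fun u => (g u) * ψ u)]
    refine Finset.sum_congr rfl fun u _ => ?_
    have hψy : ψ (y ^ p ^ f - y) = 1 := by
      rw [AddChar.map_sub_eq_div, hinv, div_self (norm_ne_zero_iff.mp (by simp))]
    rw [Equiv.coe_addLeft, AddChar.map_add_eq_mul, hψy, one_mul]
  have havg : (Fintype.card E : ℂ) * kloostermanSum ψ a =
      ∑ u, (∑ y, g (y ^ p ^ f - y + u)) * ψ u := by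
    simp_rw [Finset.sum_mul]
    rw [Finset.sum_comm, Finset.sum_congr rfl fun y _ => htrans y]
    simp
  have hbound : (Fintype.card E : ℝ) * ‖kloostermanSum ψ a‖ ≤
      Fintype.card E * (4 * p ^ f * (2 * l + 1)) := by
    calc (Fintype.card E : ℝ) * ‖kloostermanSum ψ a‖
        = ‖∑ u, (∑ y, g (y ^ p ^ f - y + u)) * ψ u‖ := by rw [← havg, norm_mul]; simp
      _ ≤ ∑ u : E, 4 * (p : ℝ) ^ f * (2 * l + 1) := by
          refine (norm_sum_le _ _).trans (Finset.sum_le_sum fun u _ => ?_)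
          rw [norm_mul, AddChar.norm_apply, mul_one]
          simp only [g, ← Int.cast_sum]
          rw [Complex.norm_intCast]
          exact_mod_cast hshift u
      _ = _ := by simp
  exact le_of_mul_le_mul_left hbound (by exact_mod_cast Fintype.card_pos)

end KloostermanSum

instance quadraticAlgebraFintype {E : Type*} [Fintype E] (a b : E) : Fintype (QuadraticAlgebra E a b) :=
  Fintype.ofEquiv _ (QuadraticAlgebra.equivProd a b).symm

lemma card_quadraticAlgebra {E : Type*} [Fintype E] (a b : E) :
    Fintype.card (QuadraticAlgebra E a b) = Fintype.card E ^ 2 := by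
  rw [Fintype.card_congr (QuadraticAlgebra.equivProd a b), Fintype.card_prod, sq]

section TraceCharacter

variable {E : Type*} [Field E]

/-- The composition of an additive character with the trace of a quadratic algebra. -/
noncomputable def traceChar (ψ : AddChar E ℂ) (δ : E) : AddChar (QuadraticAlgebra E δ 0) ℂ :=
  ψ.compAddMonoidHom (QuadraticAlgebra.trace (R := E) (a := δ) (b := 0)).toAddMonoidHom

lemma traceChar_apply (ψ : AddChar E ℂ) (δ : E) (z : QuadraticAlgebra E δ 0) :
    traceChar ψ δ z = ψ (2 * z.re) := by
  simp [traceChar, QuadraticAlgebra.trace_def]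

lemma traceChar_ne_one (hF : ringChar E ≠ 2) {ψ : AddChar E ℂ} (hψ : ψ ≠ 1) (δ : E) :
    traceChar ψ δ ≠ 1 := by
  have h2 : (2 : E) ≠ 0 := Ring.two_ne_zero hF
  obtain ⟨x, hx⟩ := AddChar.ne_one_iff.mp hψ
  refine AddChar.ne_one_iff.mpr ⟨⟨x / 2, 0⟩, ?_⟩
  rw [traceChar_apply]
  simpa [mul_div_cancel₀ _ h2] using hx

lemma traceChar_pow {p f : ℕ} [Fact p.Prime] [CharP E p] (hp : p ≠ 2) {ψ : AddChar E ℂ}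
    (hinv : ∀ y, ψ (y ^ p ^ f) = ψ y) (δ : E) (z : QuadraticAlgebra E δ 0) :
    traceChar ψ δ (z ^ p ^ f) = traceChar ψ δ z := by
  have : CharP (QuadraticAlgebra E δ 0) p :=
    charP_of_injective_algebraMap QuadraticAlgebra.algebraMap_injective p
  have hodd : Odd (p ^ f) := ((Fact.out : p.Prime).odd_of_ne_two hp).pow
  obtain ⟨k, hk⟩ := hodd
  have hz : z = algebraMap E _ z.re + algebraMap E _ z.im * QuadraticAlgebra.omega := by
    ext <;> simp
  have hω : (QuadraticAlgebra.omega : QuadraticAlgebra E δ 0) ^ p ^ f =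
      algebraMap E _ (δ ^ k) * QuadraticAlgebra.omega := by
    rw [hk, pow_succ, pow_mul, sq, QuadraticAlgebra.omega_mul_omega_eq_mk, map_pow]
    rfl
  have hre : (z ^ p ^ f).re = z.re ^ p ^ f := by
    conv_lhs => rw [hz, add_pow_char_pow, mul_pow, hω, ← map_pow, ← map_pow]
    simp only [QuadraticAlgebra.re_add, QuadraticAlgebra.re_mul, QuadraticAlgebra.im_mul,
      QuadraticAlgebra.algebraMap_re, QuadraticAlgebra.algebraMap_im, QuadraticAlgebra.omega_re,
      QuadraticAlgebra.omega_im]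
    ring
  rw [traceChar_apply, traceChar_apply, hre, two_mul, two_mul, AddChar.map_add_eq_mul,
    AddChar.map_add_eq_mul, hinv]

end TraceCharacter

section QuadraticExtension

variable {E : Type*} [Field E] [Fintype E] [DecidableEq E]

lemma sum_comp_sq (hF : ringChar E ≠ 2) (G : E → ℂ) :
    ∑ y, G (y ^ 2) = ∑ m, ((quadraticChar E m : ℂ) + 1) * G m := by
  rw [← Finset.sum_fiberwise (s := univ) (g := fun y : E => y ^ 2)]
  refine Finset.sum_congr rfl fun m _ => ?_
  have := card_filter_sq_eq hF m
  rw [← Int.cast_one, ← Int.cast_add, ← this, Int.cast_natCast, ← nsmul_eq_mul, ← Finset.sum_const]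
  refine Finset.sum_congr rfl fun x hx => ?_
  rw [(Finset.mem_filter.mp hx).2]

lemma sum_comp_mul_sq_add_sum_comp_sq (hF : ringChar E ≠ 2) {δ : E} (hδ : ¬ IsSquare δ)
    (G : E → ℂ) : ∑ y, G (δ * y ^ 2) + ∑ y, G (y ^ 2) = 2 * ∑ m, G m := by
  have hδ0 : δ ≠ 0 := fun h => hδ (h ▸ IsSquare.zero)
  have hχ : quadraticChar E δ = -1 := quadraticChar_neg_one_iff_not_isSquare.mpr hδ
  rw [sum_comp_sq hF, sum_comp_sq hF (fun m => G (δ * m))]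
  rw [← Equiv.sum_comp (Equiv.mulLeft₀ δ hδ0) (fun m => ((quadraticChar E m : ℂ) + 1) * G m),
    ← Equiv.sum_comp (Equiv.mulLeft₀ δ hδ0) G, Finset.mul_sum, ← Finset.sum_add_distrib]
  refine Finset.sum_congr rfl fun m _ => ?_
  change _ + ((quadraticChar E (δ * m) : ℂ) + 1) * G (δ * m) = 2 * G (δ * m)
  rw [map_mul, hχ]
  push_cast
  ring

/-- The summand of a Kloosterman sum over a quadratic étale algebra at an element with half-trace
`x` and norm `n`. -/
noncomputable def kloostermanTerm (ψ : AddChar E ℂ) (a x n : E) : ℂ :=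
  if n = 0 then 0 else ψ (x * (2 * (1 + a * n⁻¹)))

lemma sum_kloostermanTerm (hF : ringChar E ≠ 2) {ψ : AddChar E ℂ} (hψ : ψ ≠ 1) {a : E}
    (ha : a ≠ 0) : ∑ x, ∑ n, kloostermanTerm ψ a x n = Fintype.card E := by
  have h2 : (2 : E) ≠ 0 := Ring.two_ne_zero hF
  rw [Finset.sum_comm]
  have (n : E) : ∑ x, kloostermanTerm ψ a x n = if n = -a then (Fintype.card E : ℂ) else 0 := by
    unfold kloostermanTerm
    by_cases hn : n = 0
    · have : n ≠ -a := fun h => ha (by rw [← neg_eq_zero, ← h, hn])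
      simp [hn, hn ▸ this]
    · simp only [hn, if_false]
      rw [AddChar.sum_mulShift _ (AddChar.IsPrimitive.of_ne_one hψ)]
      have : 2 * (1 + a * n⁻¹) = 0 ↔ n = -a := by
        rw [mul_eq_zero, or_iff_right h2]
        rw [← mul_left_inj' hn, add_mul, one_mul, inv_mul_cancel_right₀ hn, zero_mul,
          add_eq_zero_iff_eq_neg]
      simp [this]
  simp [this]

lemma kloostermanSum_sq (hF : ringChar E ≠ 2) (ψ : AddChar E ℂ) (a : E) :
    kloostermanSum ψ a ^ 2 = ∑ x, ∑ y, kloostermanTerm ψ a x (x ^ 2 - y ^ 2) := by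
  have h2 : (2 : E) ≠ 0 := Ring.two_ne_zero hF
  rw [sq, kloostermanSum, Finset.sum_mul_sum, ← Finset.sum_product', ← Finset.sum_product']
  simp only [kloostermanTerm]
  symm
  rw [← Finset.sum_filter_ne_zero]
  refine Finset.sum_bij_ne_zero (fun z _ _ => (z.1 + z.2, z.1 - z.2)) ?_ ?_ ?_ ?_
  · rintro ⟨x, y⟩ _ h
    have h' : x ^ 2 - y ^ 2 ≠ 0 := fun h0 => h (by simp [h0])
    rw [sq_sub_sq] at h'
    simpa using ⟨left_ne_zero_of_mul h', right_ne_zero_of_mul h'⟩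
  · rintro ⟨x, y⟩ _ _ ⟨x', y'⟩ _ _ h
    simp only [Prod.mk.injEq] at h
    have hx : 2 * x = 2 * x' := by linear_combination h.1 + h.2
    have hy : 2 * y = 2 * y' := by linear_combination h.1 - h.2
    exact Prod.ext (mul_left_cancel₀ h2 hx) (mul_left_cancel₀ h2 hy)
  · rintro ⟨u, v⟩ huv h
    simp only [mem_product, mem_filter, mem_univ, true_and] at huv
    have hne : ((u + v) / 2) ^ 2 - ((u - v) / 2) ^ 2 ≠ 0 := by
      rw [show ((u + v) / 2) ^ 2 - ((u - v) / 2) ^ 2 = u * v by field_simp; ring]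
      exact mul_ne_zero huv.1 huv.2
    refine ⟨((u + v) / 2, (u - v) / 2), ?_, ?_, ?_⟩
    · simp only [mem_filter, mem_product, mem_univ, true_and, if_neg hne]
      exact norm_ne_zero_iff.mp (by simp)
    · simp only [if_neg hne]
      exact norm_ne_zero_iff.mp (by simp)
    · ext <;> simp only <;> field_simp <;> ring
  · rintro ⟨x, y⟩ _ h
    have h' : x ^ 2 - y ^ 2 ≠ 0 := fun h0 => h (by simp [h0])
    simp only [if_neg h']
    rw [← AddChar.map_add_eq_mul]
    rw [sq_sub_sq] at h' ⊢
    have h1 := left_ne_zero_of_mul h'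
    have h3 := right_ne_zero_of_mul h'
    congr 1
    field_simp
    ring

/-- The Kloosterman sums over a finite field `E` and its quadratic extension. -/
lemma kloostermanSum_traceChar (hF : ringChar E ≠ 2) {ψ : AddChar E ℂ} (hψ : ψ ≠ 1) {a : E}
    (ha : a ≠ 0) {δ : E} (hδ : ¬ IsSquare δ) [Fact (∀ r : E, r ^ 2 ≠ δ + 0 * r)]
    [DecidableEq (QuadraticAlgebra E δ 0)] :
    kloostermanSum (traceChar ψ δ) (algebraMap E (QuadraticAlgebra E δ 0) a) =
      2 * Fintype.card E - kloostermanSum ψ a ^ 2 := by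
  have hext : kloostermanSum (traceChar ψ δ) (algebraMap E (QuadraticAlgebra E δ 0) a) =
      ∑ x, ∑ y, kloostermanTerm ψ a x (x ^ 2 - δ * y ^ 2) := by
    rw [kloostermanSum, ← Fintype.sum_prod_type', Finset.sum_filter,
      ← Equiv.sum_comp (QuadraticAlgebra.equivProd δ 0)]
    refine Finset.sum_congr rfl fun z _ => ?_
    have hnorm : QuadraticAlgebra.norm z = z.re ^ 2 - δ * z.im ^ 2 := by
      rw [QuadraticAlgebra.norm_def]; ring
    rw [kloostermanTerm]
    change _ = if z.re ^ 2 - δ * z.im ^ 2 = 0 then 0 else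
      ψ (z.re * (2 * (1 + a * (z.re ^ 2 - δ * z.im ^ 2)⁻¹)))
    rw [← hnorm]
    simp only [QuadraticAlgebra.norm_eq_zero_iff_eq_zero, ite_not]
    congr 1
    rw [traceChar_apply]
    congr 1
    simp [QuadraticAlgebra.re_inv]
    ring
  rw [hext, kloostermanSum_sq hF, eq_sub_iff_add_eq, ← sum_kloostermanTerm hF hψ ha,
    ← Finset.sum_add_distrib, Finset.mul_sum]
  refine Finset.sum_congr rfl fun x _ => ?_
  rw [sum_comp_mul_sq_add_sum_comp_sq hF hδ (fun m => kloostermanTerm ψ a x (x ^ 2 - m)),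
    ← Equiv.sum_comp (Equiv.subLeft (x ^ 2)) (kloostermanTerm ψ a x)]
  rfl

end QuadraticExtension

section WeilBound

universe u

variable {E : Type u} [Field E] [Fintype E] [DecidableEq E]

lemma exists_extension_kloostermanSum {p f : ℕ} [Fact p.Prime] [CharP E p] (hp : p ≠ 2)
    {ψ : AddChar E ℂ} (hψ : ψ ≠ 1) (hinv : ∀ y, ψ (y ^ p ^ f) = ψ y) {a : E} (ha : a ≠ 0) :
    ∃ (E' : Type u) (_ : Field E') (_ : Fintype E') (_ : DecidableEq E') (_ : CharP E' p)
      (ψ' : AddChar E' ℂ) (a' : E'), ψ' ≠ 1 ∧ (∀ y, ψ' (y ^ p ^ f) = ψ' y) ∧ a' ≠ 0 ∧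
      Fintype.card E' = Fintype.card E ^ 2 ∧
      ‖kloostermanSum ψ a‖ ^ 2 ≤ 2 * Fintype.card E + ‖kloostermanSum ψ' a'‖ := by
  classical
  have hF : ringChar E ≠ 2 := by rwa [ringChar.eq E p]
  obtain ⟨δ, hδ⟩ := FiniteField.exists_nonsquare hF
  have : Fact (∀ r : E, r ^ 2 ≠ δ + 0 * r) :=
    ⟨fun r hr => hδ ⟨r, by rw [← sq, hr, zero_mul, add_zero]⟩⟩
  refine ⟨QuadraticAlgebra E δ 0, inferInstance, inferInstance, inferInstance,
    charP_of_injective_algebraMap QuadraticAlgebra.algebraMap_injective p, traceChar ψ δ,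
    algebraMap E _ a, traceChar_ne_one hF hψ δ, traceChar_pow hp hinv δ, ?_,
    card_quadraticAlgebra δ 0, ?_⟩
  · simpa using ha
  · have h := kloostermanSum_traceChar hF hψ ha hδ
    rw [← norm_pow, show kloostermanSum ψ a ^ 2 = 2 * Fintype.card E -
      kloostermanSum (traceChar ψ δ) (algebraMap E (QuadraticAlgebra E δ 0) a) by rw [h]; ring]
    refine (norm_sub_le _ _).trans_eq ?_
    simp

/-- Passing to iterated quadratic extensions amplifies an excess over the Weil bound. -/
lemma two_add_four_pow_mul_le {p f : ℕ} [Fact p.Prime] (hp : p ≠ 2) (hf : f ≠ 0) (k : ℕ) :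
    ∀ {E : Type u} [Field E] [Fintype E] [DecidableEq E] [CharP E p] {e l : ℕ} {ψ : AddChar E ℂ}
      {a : E} {ε : ℝ}, p ^ e = 2 * l + 1 → Fintype.card E = (2 * l + 1) ^ 2 → p ^ f ≤ l → ψ ≠ 1 →
      (∀ y, ψ (y ^ p ^ f) = ψ y) → a ≠ 0 → 0 ≤ ε →
      (2 + ε) * (2 * l + 1) ≤ ‖kloostermanSum ψ a‖ → 2 + 4 ^ k * ε ≤ 4 * p ^ f := by
  induction k with
  | zero =>
    intro E _ _ _ _ e l ψ a ε hs hE hl hψ hinv ha _ h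
    have := h.trans (norm_kloostermanSum_le_of_frobenius_invariant hs hE hl hf hψ hinv ha)
    simpa using le_of_mul_le_mul_right this (by positivity)
  | succ k ih =>
    intro E _ _ _ _ e l ψ a ε hs hE hl hψ hinv ha hε h
    obtain ⟨E', _, _, _, _, ψ', a', hψ', hinv', ha', hE', hK⟩ :=
      exists_extension_kloostermanSum hp hψ hinv ha
    rw [pow_succ, mul_assoc]
    refine ih (E := E') (e := e * 2) (l := 2 * l ^ 2 + 2 * l) ?_ ?_ ?_ hψ' hinv' ha'
      (by positivity) ?_
    · rw [pow_mul, hs]; ring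
    · rw [hE', hE]; ring
    · nlinarith
    · have h2 := pow_le_pow_left₀ (by positivity) h 2
      rw [hE] at hK
      push_cast at hK ⊢
      nlinarith [mul_nonneg (sq_nonneg ε) (sq_nonneg (2 * (l : ℝ) + 1))]

lemma norm_kloostermanSum_le_of_card_eq_sq {p e f l : ℕ} [Fact p.Prime] [CharP E p] (hp : p ≠ 2)
    (hf : f ≠ 0) (hs : p ^ e = 2 * l + 1) (hE : Fintype.card E = (2 * l + 1) ^ 2) (hl : p ^ f ≤ l)
    {ψ : AddChar E ℂ} (hψ : ψ ≠ 1) (hinv : ∀ y, ψ (y ^ p ^ f) = ψ y) {a : E} (ha : a ≠ 0) :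
    ‖kloostermanSum ψ a‖ ≤ 2 * (2 * l + 1) := by
  by_contra! hlt
  have hl0 : (0 : ℝ) < 2 * l + 1 := by positivity
  set ε := ‖kloostermanSum ψ a‖ / (2 * l + 1) - 2 with hε
  have hε0 : 0 < ε := by rw [hε, sub_pos, lt_div_iff₀ hl0]; exact hlt
  have hK : (2 + ε) * (2 * l + 1) ≤ ‖kloostermanSum ψ a‖ := by
    rw [hε, add_sub_cancel, div_mul_cancel₀ _ hl0.ne']
  obtain ⟨k, hk⟩ := pow_unbounded_of_one_lt (4 * p ^ f / ε) (by norm_num : (1 : ℝ) < 4)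
  rw [div_lt_iff₀ hε0] at hk
  linarith [two_add_four_pow_mul_le hp hf k hs hE hl hψ hinv ha hε0.le hK]

/-- Weil's bound for Kloosterman sums over finite fields of odd characteristic. -/
theorem norm_kloostermanSum_le (hF : ringChar E ≠ 2) {ψ : AddChar E ℂ} (hψ : ψ ≠ 1) {a : E}
    (ha : a ≠ 0) : ‖kloostermanSum ψ a‖ ≤ 2 * √(Fintype.card E) := by
  obtain ⟨p, hchar⟩ := CharP.exists E
  obtain ⟨f, hp, hcard⟩ := FiniteField.card E p
  have : Fact p.Prime := ⟨hp⟩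
  have hp2 : p ≠ 2 := by rwa [← ringChar.eq E p]
  have hinv (y : E) : ψ (y ^ p ^ (f : ℕ)) = ψ y := by rw [← hcard, FiniteField.pow_card]
  obtain ⟨E₁, _, _, _, _, ψ₁, a₁, hψ₁, hinv₁, ha₁, hE₁, hK₁⟩ :=
    exists_extension_kloostermanSum hp2 hψ hinv ha
  obtain ⟨E₂, _, _, _, _, ψ₂, a₂, hψ₂, hinv₂, ha₂, hE₂, hK₂⟩ :=
    exists_extension_kloostermanSum hp2 hψ₁ hinv₁ ha₁
  obtain ⟨l, hl⟩ : Odd (Fintype.card E ^ 2) := by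
    rw [hcard]; exact ((hp.odd_of_ne_two hp2).pow).pow
  have h3 : 3 ≤ Fintype.card E := by
    rw [hcard]
    exact (lt_of_le_of_ne hp.two_le hp2.symm).trans_le (Nat.le_self_pow f.ne_zero p)
  have hle : p ^ (f : ℕ) ≤ l := by rw [← hcard]; nlinarith
  have h2 := norm_kloostermanSum_le_of_card_eq_sq (E := E₂) (e := f * 2) hp2 f.ne_zero
    (by rw [pow_mul, ← hcard, hl]) (by rw [hE₂, hE₁, hl]) hle hψ₂ hinv₂ ha₂
  have hlR : (Fintype.card E : ℝ) ^ 2 = 2 * l + 1 := by exact_mod_cast hl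
  have hc : (0 : ℝ) ≤ Fintype.card E := by positivity
  rw [hE₁] at hK₂
  push_cast at hK₂
  have h1 : ‖kloostermanSum ψ₁ a₁‖ ≤ 2 * Fintype.card E :=
    abs_le_of_sq_le_sq' (by nlinarith) (by positivity) |>.2
  refine abs_le_of_sq_le_sq' ?_ (by positivity) |>.2
  rw [mul_pow, Real.sq_sqrt hc]
  linarith

end WeilBound

section TwistedKloosterman

variable {F : Type*} [Field F] [Fintype F]

/-- The quadratic Gauss sum of an additive character. -/
noncomputable def quadraticGaussSum (ψ : AddChar F ℂ) : ℂ := ∑ x, ψ (x ^ 2)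

variable [DecidableEq F]

lemma sum_comp_mul_sq (hF : ringChar F ≠ 2) {ψ : AddChar F ℂ} (hψ : ψ ≠ 1) {t : F} (ht : t ≠ 0) :
    ∑ x, ψ (t * x ^ 2) = ∑ m, (quadraticChar F m : ℂ) * ψ (t * m) := by
  rw [sum_comp_sq hF (fun m => ψ (t * m))]
  have h := AddChar.sum_mulShift t (AddChar.IsPrimitive.of_ne_one hψ)
  simp only [mul_comm _ t, if_neg ht] at h
  simp only [add_mul, one_mul, Finset.sum_add_distrib, h]
  simp

lemma quadraticGaussSum_eq (hF : ringChar F ≠ 2) {ψ : AddChar F ℂ} (hψ : ψ ≠ 1) :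
    quadraticGaussSum ψ = ∑ m, (quadraticChar F m : ℂ) * ψ m := by
  simpa [quadraticGaussSum] using sum_comp_mul_sq hF hψ one_ne_zero

lemma sum_addChar_mul_sq (hF : ringChar F ≠ 2) {ψ : AddChar F ℂ} (hψ : ψ ≠ 1) {t : F}
    (ht : t ≠ 0) : ∑ x, ψ (t * x ^ 2) = quadraticChar F t * quadraticGaussSum ψ := by
  rw [sum_comp_mul_sq hF hψ ht, quadraticGaussSum_eq hF hψ, Finset.mul_sum,
    ← Equiv.sum_comp (Equiv.mulLeft₀ t ht) (fun m => (quadraticChar F t : ℂ) * _)]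
  refine Finset.sum_congr rfl fun m _ => ?_
  change _ = (quadraticChar F t : ℂ) * ((quadraticChar F (t * m) : ℂ) * ψ (t * m))
  rw [← mul_assoc, ← Int.cast_mul, map_mul (quadraticChar F), ← mul_assoc, ← sq,
    quadraticChar_sq_one ht, one_mul]

lemma sum_addChar_mul_sq_add_mul (hF : ringChar F ≠ 2) {ψ : AddChar F ℂ} (hψ : ψ ≠ 1) {t : F}
    (ht : t ≠ 0) (b : F) :
    ∑ x, ψ (t * x ^ 2 + x * b) =
      quadraticChar F t * quadraticGaussSum ψ * ψ (-b ^ 2 * (4 * t)⁻¹) := by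
  have h2 : (2 : F) ≠ 0 := Ring.two_ne_zero hF
  rw [← sum_addChar_mul_sq hF hψ ht, Finset.sum_mul,
    ← Equiv.sum_comp (Equiv.addRight (b * (2 * t)⁻¹)) (fun x => ψ (t * x ^ 2) * _)]
  refine Finset.sum_congr rfl fun x _ => ?_
  rw [← AddChar.map_add_eq_mul, Equiv.coe_addRight, show (4 : F) = 2 * 2 by norm_num]
  congr 1
  field_simp
  ring

lemma quadraticGaussSum_sq (hF : ringChar F ≠ 2) {ψ : AddChar F ℂ} (hψ : ψ ≠ 1) :
    quadraticGaussSum ψ ^ 2 = quadraticChar F (-1) * Fintype.card F := by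
  have h := gaussSum_sq (R := F) (R' := ℂ)
    (χ := (quadraticChar F).ringHomComp (Int.castRingHom ℂ)) (ψ := ψ)
    ((MulChar.ringHomComp_ne_one_iff (RingHom.injective_int _)).mpr (quadraticChar_ne_one hF))
    ((quadraticChar_isQuadratic F).comp _) (AddChar.IsPrimitive.of_ne_one hψ)
  simpa [gaussSum, quadraticGaussSum_eq hF hψ] using h

lemma norm_quadraticChar_of_ne_zero {t : F} (ht : t ≠ 0) : ‖(quadraticChar F t : ℂ)‖ = 1 := by
  rcases quadraticChar_dichotomy ht with h | h <;> simp [h]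

lemma norm_quadraticGaussSum (hF : ringChar F ≠ 2) {ψ : AddChar F ℂ} (hψ : ψ ≠ 1) :
    ‖quadraticGaussSum ψ‖ = √(Fintype.card F) := by
  rw [eq_comm, Real.sqrt_eq_iff_eq_sq (by positivity) (by positivity), ← norm_pow,
    quadraticGaussSum_sq hF hψ, norm_mul, norm_quadraticChar_of_ne_zero (neg_ne_zero.mpr one_ne_zero)]
  simp

lemma sum_ne_zero_addChar_mul {ψ : AddChar F ℂ} (hψ : ψ ≠ 1) (c : F) :
    ∑ t : F with t ≠ 0, ψ (c * t) = (if c = 0 then (Fintype.card F : ℂ) else 0) - 1 := by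
  have h := AddChar.sum_mulShift c (AddChar.IsPrimitive.of_ne_one hψ)
  rw [← Finset.sum_filter_add_sum_filter_not univ (· ≠ (0 : F))] at h
  simp only [not_not, Finset.filter_eq', Finset.mem_univ, if_true, Finset.sum_singleton,
    mul_comm _ c, mul_zero, AddChar.map_zero_eq_one] at h
  rw [Nat.cast_ite, Nat.cast_zero] at h
  rw [← h, add_sub_cancel_right]

lemma sum_ne_zero_addChar_mul_inv {ψ : AddChar F ℂ} (hψ : ψ ≠ 1) (c : F) :
    ∑ t : F with t ≠ 0, ψ (c * t⁻¹) = (if c = 0 then (Fintype.card F : ℂ) else 0) - 1 := by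
  rw [← sum_ne_zero_addChar_mul hψ]
  refine Finset.sum_nbij' (·⁻¹) (·⁻¹) ?_ ?_ ?_ ?_ ?_ <;> simp

/-- The quadratic twist of a Kloosterman sum (a Salié sum) has the same bound. -/
lemma norm_sum_quadraticChar_mul_addChar_le (hF : ringChar F ≠ 2) {ψ : AddChar F ℂ} (hψ : ψ ≠ 1)
    {r : F} (hr : r ≠ 0) (b : F) :
    ‖∑ t : F with t ≠ 0, (quadraticChar F t : ℂ) * ψ (r * t + b * t⁻¹)‖ ≤
      2 * √(Fintype.card F) := by
  have h2 : (2 : F) ≠ 0 := Ring.two_ne_zero hF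
  have h4 : (4 : F) ≠ 0 := by rw [show (4 : F) = 2 * 2 by norm_num]; exact mul_ne_zero h2 h2
  set W := ∑ t : F with t ≠ 0, (quadraticChar F t : ℂ) * ψ (r * t + b * t⁻¹) with hW
  have hterm (t : F) (ht : t ≠ 0) :
      quadraticGaussSum ψ * ((quadraticChar F t : ℂ) * ψ (r * t + b * t⁻¹)) =
        quadraticChar F (-r) * ∑ v, ψ v * ψ ((b - v ^ 2 * (4 * r)⁻¹) * t⁻¹) := by
    have hs : -(4 * r * t)⁻¹ ≠ 0 := by simp [hr, ht, h4]
    have hχ : quadraticChar F (-(4 * r * t)⁻¹) = quadraticChar F (-r) * quadraticChar F t := by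
      rw [← map_mul, show -(4 * r * t)⁻¹ = (-r * t) * ((2 * r * t)⁻¹) ^ 2 by
        rw [show (4 : F) = 2 * 2 by norm_num]; field_simp, map_mul,
        quadraticChar_sq_one' (by simp [hr, ht, h2]), mul_one]
    have hsum : ∑ v, ψ v * ψ ((b - v ^ 2 * (4 * r)⁻¹) * t⁻¹) =
        (∑ v, ψ (-(4 * r * t)⁻¹ * v ^ 2 + v * 1)) * ψ (b * t⁻¹) := by
      rw [Finset.sum_mul]
      refine Finset.sum_congr rfl fun v _ => ?_
      rw [← AddChar.map_add_eq_mul, ← AddChar.map_add_eq_mul]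
      congr 1
      field_simp
      ring
    have hsq : (quadraticChar F (-r) : ℂ) ^ 2 = 1 := by
      exact_mod_cast quadraticChar_sq_one (neg_ne_zero.mpr hr)
    rw [hsum, sum_addChar_mul_sq_add_mul hF hψ hs, hχ,
      show -(1 : F) ^ 2 * (4 * -(4 * r * t)⁻¹)⁻¹ = r * t by field_simp, AddChar.map_add_eq_mul]
    push_cast
    linear_combination -(quadraticGaussSum ψ * quadraticChar F t * ψ (r * t) * ψ (b * t⁻¹)) * hsq
  have hGW : quadraticGaussSum ψ * W =
      quadraticChar F (-r) * (Fintype.card F * ∑ v : F with v ^ 2 = 4 * r * b, ψ v) := by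
    rw [hW, Finset.mul_sum, Finset.sum_congr rfl fun t ht => hterm t (Finset.mem_filter.mp ht).2,
      ← Finset.mul_sum, Finset.sum_comm]
    congr 1
    simp only [← Finset.mul_sum, sum_ne_zero_addChar_mul_inv hψ, mul_sub, mul_one,
      Finset.sum_sub_distrib, AddChar.sum_eq_zero_iff_ne_zero.mpr hψ, sub_zero]
    rw [Finset.mul_sum, Finset.sum_filter]
    refine Finset.sum_congr rfl fun v _ => ?_
    have : b - v ^ 2 * (4 * r)⁻¹ = 0 ↔ v ^ 2 = 4 * r * b := by
      rw [sub_eq_zero, eq_comm, mul_inv_eq_iff_eq_mul₀ (mul_ne_zero h4 hr), mul_comm b]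
    simp only [this]
    split_ifs <;> ring
  have hcard : (#{v : F | v ^ 2 = 4 * r * b} : ℝ) ≤ 2 := by
    have h := card_filter_sq_eq hF (4 * r * b)
    have h1 : quadraticChar F (4 * r * b) ≤ 1 := by
      by_cases h0 : 4 * r * b = 0
      · simp [h0]
      · rcases quadraticChar_dichotomy h0 with h | h <;> simp [h]
    have : #{v : F | v ^ 2 = 4 * r * b} ≤ 2 := by omega
    exact_mod_cast this
  have hsum : ‖∑ v : F with v ^ 2 = 4 * r * b, ψ v‖ ≤ 2 :=
    (norm_sum_le _ _).trans (by simpa using hcard)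
  have hq : 0 < √(Fintype.card F : ℝ) := Real.sqrt_pos.mpr (by exact_mod_cast Fintype.card_pos)
  have hnorm := congrArg norm hGW
  rw [norm_mul, norm_quadraticGaussSum hF hψ, norm_mul, norm_mul,
    norm_quadraticChar_of_ne_zero (neg_ne_zero.mpr hr), one_mul, Complex.norm_natCast,
    ← Real.mul_self_sqrt (Nat.cast_nonneg (α := ℝ) (Fintype.card F)), Real.sqrt_mul_self hq.le,
    mul_assoc] at hnorm
  rw [mul_left_cancel₀ hq.ne' hnorm, mul_comm]
  gcongr

lemma norm_sum_addChar_le (hF : ringChar F ≠ 2) {ψ : AddChar F ℂ} (hψ : ψ ≠ 1)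
    {r : F} (hr : r ≠ 0) (b : F) :
    ‖∑ t : F with t ≠ 0, ψ (r * t + b * t⁻¹)‖ ≤ 2 * √(Fintype.card F) := by
  have hsum : ∑ t : F with t ≠ 0, ψ (r * t + b * t⁻¹) =
      ∑ t : F with t ≠ 0, ψ (t + r * b * t⁻¹) := by
    refine Finset.sum_nbij' (r * ·) (r⁻¹ * ·) ?_ ?_ ?_ ?_ fun t _ => ?_
    rotate_left 4
    · congr 2
      field_simp
    all_goals simp [hr]
  rw [hsum]
  by_cases hb : b = 0
  · have h := sum_ne_zero_addChar_mul hψ 1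
    simp only [one_mul, one_ne_zero, if_false, zero_sub] at h
    simp only [hb, mul_zero, zero_mul, add_zero]
    rw [h, norm_neg, norm_one]
    have : (1 : ℝ) ≤ √(Fintype.card F) :=
      Real.one_le_sqrt.mpr (by exact_mod_cast Fintype.card_pos)
    linarith
  · exact norm_kloostermanSum_le hF hψ (mul_ne_zero hr hb)

lemma norm_sum_quadraticChar_pow_mul_addChar_le (hF : ringChar F ≠ 2) {ψ : AddChar F ℂ}
    (hψ : ψ ≠ 1) (d : ℕ) {r : F} (hr : r ≠ 0) (b : F) :
    ‖∑ t : F with t ≠ 0, (quadraticChar F t : ℂ) ^ d * ψ (r * t + b * t⁻¹)‖ ≤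
      2 * √(Fintype.card F) := by
  have hsq (t : F) (ht : t ≠ 0) : (quadraticChar F t : ℂ) ^ 2 = 1 := by
    exact_mod_cast quadraticChar_sq_one ht
  rcases Nat.even_or_odd' d with ⟨k, rfl | rfl⟩
  · rw [Finset.sum_congr rfl fun t ht => by
      rw [pow_mul, hsq t (Finset.mem_filter.mp ht).2, one_pow, one_mul]]
    exact norm_sum_addChar_le hF hψ hr b
  · rw [Finset.sum_congr rfl fun t ht => by
      rw [pow_succ, pow_mul, hsq t (Finset.mem_filter.mp ht).2, one_pow, one_mul]]
    exact norm_sum_quadraticChar_mul_addChar_le hF hψ hr b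

end TwistedKloosterman

section Incidences

lemma addChar_map_sum {A M ι : Type*} [AddCommMonoid A] [CommMonoid M] (ψ : AddChar A M)
    (s : Finset ι) (f : ι → A) : ψ (∑ i ∈ s, f i) = ∏ i ∈ s, ψ (f i) :=
  map_prod ψ.toMonoidHom (fun i => Multiplicative.ofAdd (f i)) s

lemma addChar_dotProduct_sub {R : Type*} [CommRing R] [Finite R] (ψ : AddChar R ℂ)
    {d : ℕ} (m x y : Fin d → R) : ψ (m ⬝ᵥ (x - y)) = ψ (m ⬝ᵥ x) * (starRingEnd ℂ) (ψ (m ⬝ᵥ y)) := by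
  rw [dotProduct_sub, sub_eq_add_neg, AddChar.map_add_eq_mul, AddChar.map_neg_eq_conj]

variable {F : Type*} [Field F] [Fintype F] [DecidableEq F] {d : ℕ}

lemma sum_addChar_dotProduct {ψ : AddChar F ℂ} (hψ : ψ ≠ 1) (z : Fin d → F) :
    ∑ m : Fin d → F, ψ (m ⬝ᵥ z) = if z = 0 then (Fintype.card F : ℂ) ^ d else 0 := by
  simp only [dotProduct, addChar_map_sum]
  rw [← Fintype.piFinset_univ, ← Finset.prod_univ_sum (fun _ => univ) fun i m => ψ (m * z i)]
  simp only [AddChar.sum_mulShift _ (AddChar.IsPrimitive.of_ne_one hψ)]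
  split_ifs with h
  · simp [h]
  · obtain ⟨i, hi⟩ := Function.ne_iff.mp h
    exact Finset.prod_eq_zero (Finset.mem_univ i) (by simpa using hi)

lemma sum_norm_sq_sum_addChar_dotProduct {ψ : AddChar F ℂ} (hψ : ψ ≠ 1)
    (P : Finset (Fin d → F)) :
    ∑ m : Fin d → F, ‖∑ x ∈ P, ψ (m ⬝ᵥ x)‖ ^ 2 = (Fintype.card F : ℝ) ^ d * #P := by
  have hterm (m : Fin d → F) : ((‖∑ x ∈ P, ψ (m ⬝ᵥ x)‖ ^ 2 : ℝ) : ℂ) =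
      ∑ x ∈ P, ∑ y ∈ P, ψ (m ⬝ᵥ (x - y)) := by
    rw [Complex.ofReal_pow, ← Complex.mul_conj', map_sum, Finset.sum_mul_sum]
    simp only [addChar_dotProduct_sub]
  rw [← Complex.ofReal_inj, Complex.ofReal_sum]
  simp only [hterm]
  rw [Finset.sum_comm]
  simp_rw [Finset.sum_comm (s := univ), sum_addChar_dotProduct hψ, sub_eq_zero]
  simp [mul_comm]

lemma sum_addChar_normForm_add_dotProduct (hF : ringChar F ≠ 2) {ψ : AddChar F ℂ} (hψ : ψ ≠ 1)
    {t : F} (ht : t ≠ 0) (z : Fin d → F) :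
    ∑ m : Fin d → F, ψ (-(4 * t)⁻¹ * normForm m + m ⬝ᵥ z) =
      (quadraticChar F (-t) * quadraticGaussSum ψ) ^ d * ψ (normForm z * t) := by
  have h2 : (2 : F) ≠ 0 := Ring.two_ne_zero hF
  have h4 : (4 : F) ≠ 0 := by rw [show (4 : F) = 2 * 2 by norm_num]; exact mul_ne_zero h2 h2
  have hs : -(4 * t)⁻¹ ≠ 0 := by simp [h4, ht]
  have hχ : quadraticChar F (-(4 * t)⁻¹) = quadraticChar F (-t) := by
    rw [show -(4 * t)⁻¹ = (-t) * ((2 * t)⁻¹) ^ 2 by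
      rw [show (4 : F) = 2 * 2 by norm_num]; field_simp, map_mul,
      quadraticChar_sq_one' (by simp [ht, h2]), mul_one]
  simp only [dotProduct, normForm, Finset.mul_sum, Finset.sum_mul, ← Finset.sum_add_distrib,
    addChar_map_sum]
  rw [← Fintype.piFinset_univ, ← Finset.prod_univ_sum (fun _ => univ)
    fun i m => ψ (-(4 * t)⁻¹ * m ^ 2 + m * z i)]
  simp only [sum_addChar_mul_sq_add_mul hF hψ hs, hχ, Finset.prod_mul_distrib, Finset.prod_const,
    Finset.card_univ, Fintype.card_fin, mul_pow]
  congr 1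
  refine Finset.prod_congr rfl fun i _ => ?_
  congr 1
  field_simp

/-- The Fourier expansion of the balanced indicator function of a sphere. -/
lemma card_pow_mul_ite_normForm_sub_one (hF : ringChar F ≠ 2) {ψ : AddChar F ℂ} (hψ : ψ ≠ 1)
    (r : F) (z : Fin d → F) :
    (Fintype.card F : ℂ) ^ d * ((if normForm z = r then (Fintype.card F : ℂ) else 0) - 1) =
      ∑ m : Fin d → F, quadraticGaussSum ψ ^ d *
        (∑ t : F with t ≠ 0,
          (quadraticChar F t : ℂ) ^ d * ψ (-r * t + -(4⁻¹ * normForm m) * t⁻¹)) *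
        ψ (m ⬝ᵥ z) := by
  have hterm (t : F) (ht : t ≠ 0) : (Fintype.card F : ℂ) ^ d * ψ ((normForm z - r) * t) =
      ∑ m : Fin d → F, quadraticGaussSum ψ ^ d *
        ((quadraticChar F t : ℂ) ^ d * ψ (-r * t + -(4⁻¹ * normForm m) * t⁻¹)) * ψ (m ⬝ᵥ z) := by
    have hG : (quadraticChar F t * quadraticGaussSum ψ) *
        (quadraticChar F (-t) * quadraticGaussSum ψ) = Fintype.card F := by
      have hsq : (quadraticChar F (-t) : ℂ) ^ 2 = 1 := by
        exact_mod_cast quadraticChar_sq_one (neg_ne_zero.mpr ht)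
      have hmul : (quadraticChar F t : ℂ) = quadraticChar F (-1) * quadraticChar F (-t) := by
        rw [← Int.cast_mul, ← map_mul, neg_one_mul, neg_neg]
      have hneg : (quadraticChar F (-1) : ℂ) ^ 2 = 1 := by
        exact_mod_cast congrArg (Int.cast (R := ℂ))
          (quadraticChar_sq_one (neg_ne_zero.mpr (one_ne_zero (α := F))))
      rw [hmul]
      linear_combination (quadraticChar F (-1) * quadraticChar F (-t) ^ 2 : ℂ) *
        quadraticGaussSum_sq hF hψ + Fintype.card F * (quadraticChar F (-1) : ℂ) ^ 2 * hsq +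
        Fintype.card F * hneg
    rw [← hG, mul_pow, sub_mul, sub_eq_add_neg, AddChar.map_add_eq_mul, mul_assoc,
      ← mul_assoc (_ ^ d) (ψ _), ← sum_addChar_normForm_add_dotProduct hF hψ ht, mul_pow,
      Finset.sum_mul, Finset.mul_sum]
    refine Finset.sum_congr rfl fun m _ => ?_
    have hm : ψ (-(4 * t)⁻¹ * normForm m + m ⬝ᵥ z) * ψ (-(r * t)) =
        ψ (-r * t + -(4⁻¹ * normForm m) * t⁻¹) * ψ (m ⬝ᵥ z) := by
      rw [← AddChar.map_add_eq_mul, ← AddChar.map_add_eq_mul, mul_inv]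
      congr 1
      ring
    rw [hm]
    ring
  simp only [← sub_eq_zero (b := r)]
  rw [← sum_ne_zero_addChar_mul hψ, Finset.mul_sum,
    Finset.sum_congr rfl fun t ht => hterm t (Finset.mem_filter.mp ht).2, Finset.sum_comm]
  simp only [Finset.mul_sum, Finset.sum_mul]

/-- The incidence bound for spheres of a common nonzero radius `r` with centers in `C`. -/
lemma abs_sum_sum_ite_normForm_sub_le (hF : ringChar F ≠ 2) (hd : d ≠ 0) {r : F} (hr : r ≠ 0)
    (P C : Finset (Fin d → F)) :
    |∑ c ∈ C, ∑ x ∈ P,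
        ((if normForm (x - c) = r then 1 else 0) - (Fintype.card F : ℝ)⁻¹)| ≤
      2 * √((Fintype.card F : ℝ) ^ (d - 1) * #P) * √(#C) := by
  obtain ⟨ψ, hψ⟩ : ∃ ψ : AddChar F ℂ, ψ ≠ 1 :=
    (AddChar.exists_apply_ne_zero.mpr one_ne_zero).imp fun _ h => AddChar.ne_one_iff.mpr ⟨1, h⟩
  set q : ℝ := (Fintype.card F : ℝ) with hq
  have hq0 : 0 < q := by rw [hq]; exact_mod_cast Fintype.card_pos
  set D : ℝ := ∑ c ∈ C, ∑ x ∈ P, ((if normForm (x - c) = r then 1 else 0) - q⁻¹) with hD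
  set A : (Fin d → F) → ℂ := fun m => ∑ x ∈ P, ψ (m ⬝ᵥ x) with hA
  set B : (Fin d → F) → ℂ := fun m => ∑ c ∈ C, ψ (m ⬝ᵥ c) with hB
  set W : (Fin d → F) → ℂ := fun m => ∑ t : F with t ≠ 0,
    (quadraticChar F t : ℂ) ^ d * ψ (-r * t + -(4⁻¹ * normForm m) * t⁻¹) with hW
  have hexp : ((q ^ (d + 1) * D : ℝ) : ℂ) =
      ∑ m, quadraticGaussSum ψ ^ d * W m * (A m * (starRingEnd ℂ) (B m)) := by
    have hkey (c x : Fin d → F) :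
        ((q ^ (d + 1) * ((if normForm (x - c) = r then 1 else 0) - q⁻¹) : ℝ) : ℂ) =
          ∑ m, quadraticGaussSum ψ ^ d * W m * (ψ (m ⬝ᵥ x) * (starRingEnd ℂ) (ψ (m ⬝ᵥ c))) := by
      have h := card_pow_mul_ite_normForm_sub_one hF hψ r (x - c)
      simp only [addChar_dotProduct_sub] at h
      rw [← h, pow_succ, mul_assoc, mul_sub, mul_inv_cancel₀ hq0.ne', hq]
      split_ifs <;> simp
    simp only [hA, hB, hD, map_sum, Finset.sum_mul_sum]
    simp only [Finset.mul_sum, Complex.ofReal_sum, hkey]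
    rw [Finset.sum_comm, Finset.sum_comm (s := univ)]
    exact Finset.sum_congr rfl fun x _ => Finset.sum_comm
  have hCS : ∑ m, ‖A m‖ * ‖B m‖ ≤ √(q ^ d * #P) * √(q ^ d * #C) := by
    rw [← sum_norm_sq_sum_addChar_dotProduct hψ P, ← sum_norm_sq_sum_addChar_dotProduct hψ C]
    exact Real.sum_mul_le_sqrt_mul_sqrt _ _ _
  have hbound : q ^ (d + 1) * |D| ≤ √q ^ d * (2 * √q) * (√(q ^ d * #P) * √(q ^ d * #C)) := by
    calc q ^ (d + 1) * |D| = ‖((q ^ (d + 1) * D : ℝ) : ℂ)‖ := by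
          rw [Complex.norm_real, norm_mul, Real.norm_eq_abs, Real.norm_eq_abs,
            abs_of_pos (pow_pos hq0 _)]
      _ ≤ ∑ m, √q ^ d * (2 * √q) * (‖A m‖ * ‖B m‖) := by
          rw [hexp]
          refine norm_sum_le_of_le _ fun m _ => ?_
          rw [norm_mul, norm_mul, norm_mul, norm_pow, norm_quadraticGaussSum hF hψ, RCLike.norm_conj]
          gcongr
          exact norm_sum_quadraticChar_pow_mul_addChar_le hF hψ d (neg_ne_zero.mpr hr) _
      _ ≤ _ := by rw [← Finset.mul_sum]; gcongr
  refine le_of_mul_le_mul_left (hbound.trans_eq ?_) (pow_pos hq0 (d + 1))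
  have hs : √q ^ 2 = q := Real.sq_sqrt hq0.le
  have hpow (n : ℕ) : √(q ^ n) = √q ^ n := by
    rw [Real.sqrt_eq_iff_eq_sq (by positivity) (by positivity), ← pow_mul, mul_comm n 2, pow_mul, hs]
  have hqd : q ^ (d + 1) = (√q ^ d) ^ 2 * √q ^ 2 := by
    rw [← pow_mul, mul_comm d 2, pow_mul, hs, pow_succ]
  rw [Real.sqrt_mul (by positivity), Real.sqrt_mul (by positivity),
    Real.sqrt_mul (by positivity), hpow, hpow, hqd]
  linear_combination -2 * √q * (√q ^ d) ^ 2 * √(#P) * √(#C) * pow_sub_one_mul hd √q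

end Incidences

lemma sphIncid_sub_eq_sum {F : Type*} [Field F] [Fintype F] [DecidableEq F] {d : ℕ}
    (Qf : (Fin d → F) → F) (P : Finset (Fin d → F)) (S : Finset ((Fin d → F) × F)) (α : ℝ) :
    (sphIncid Qf P S : ℝ) - α * #P * #S =
      ∑ s ∈ S, ∑ x ∈ P, ((if Qf (x - s.1) = s.2 then 1 else 0) - α) := by
  rw [sphIncid, Finset.card_filter, Finset.sum_product_right]
  simp only [Finset.sum_sub_distrib, Finset.sum_const, nsmul_eq_mul]
  push_cast
  ring

/-- Iosevich–Rudnev incidence bound for spheres with radii in a set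
`R ⊆ F_q \ {0}`. -/
theorem stmt1 {F : Type*} [Field F] [Fintype F] [DecidableEq F]
    (hq : Odd (Fintype.card F)) {d : ℕ} (hd : 2 ≤ d)
    (R : Finset F) (hR : ∀ r ∈ R, r ≠ 0)
    (P : Finset (Fin d → F)) (S : Finset ((Fin d → F) × F))
    (hS : ∀ s ∈ S, s.2 ∈ R) :
    |(sphIncid normForm P S : ℝ) - (Fintype.card F : ℝ)⁻¹ * P.card * S.card|
      ≤ 2 * Real.sqrt ((Fintype.card F : ℝ) ^ (d-1) * R.card * P.card * S.card) := by
  have hF : ringChar F ≠ 2 := fun h =>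
    (Nat.not_even_iff_odd.mpr hq) (Nat.even_iff.mpr (FiniteField.even_card_of_char_two h))
  set q : ℝ := (Fintype.card F : ℝ)
  set C : F → Finset (Fin d → F) := fun r => {c | (c, r) ∈ S} with hC
  have hfib (s : (Fin d → F) × F) : s ∈ S ↔ s.2 ∈ R ∧ s.1 ∈ C s.2 := by
    simpa [hC] using hS s
  have hcard : ∑ r ∈ R, (#(C r) : ℝ) = #S := by
    have h := Finset.sum_finset_product_right' S R C hfib (f := fun _ _ => (1 : ℝ))
    simpa using h.symm
  have hsqrt : ∑ r ∈ R, √(#(C r) : ℝ) ≤ √(#R) * √(#S) := by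
    have h := Real.sum_mul_le_sqrt_mul_sqrt R (fun _ => 1) fun r => √(#(C r) : ℝ)
    simpa [hcard] using h
  rw [sphIncid_sub_eq_sum, Finset.sum_finset_product_right' S R C hfib
    (f := fun c r => ∑ x ∈ P, ((if normForm (x - c) = r then 1 else 0) - q⁻¹))]
  clear hfib
  calc _ ≤ ∑ r ∈ R, 2 * √(q ^ (d - 1) * #P) * √(#(C r)) :=
        (Finset.abs_sum_le_sum_abs _ _).trans <| Finset.sum_le_sum fun r hr =>
          abs_sum_sum_ite_normForm_sub_le hF (by lia) (hR r hr) P (C r)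
    _ ≤ 2 * √(q ^ (d - 1) * #P) * (√(#R) * √(#S)) := by
        rw [← Finset.mul_sum]
        gcongr
    _ = _ := by
        rw [mul_assoc, ← Real.sqrt_mul (by positivity), ← Real.sqrt_mul (by positivity)]
        congr 2
        ring
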